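/- Let I = [a,b] and let F : I → I be a PM function with forts c_1 < … < c_v (c_0 := a, c_{v+1} := b) and let 1 ≤ k ≤ v−1, with F(I) ⊆ [c_k,c_{k+1}] (so H(F) = 1 and K(F) = [c_k,c_{k+1}]) and F strictly increasing on [c_k,c_{k+1}]. Assume condition (K_0^+) fails, i.e., there exists x ∈ I with F(x) = c_k and F(c_k) ≠ c_k, or there exists x ∈ I with F(x) = c_{k+1} and F(c_{k+1}) ≠ c_{k+1}. Suppose one of: (i) c_k < F(c_{k+2}) < F(c_k) and F(c_{k−1}) = c_{k+1} = F(c_{k+1}); or (ii) c_k = F(c_k) = F(c_{k+2}) and F(c_{k+1}) < F(c_{k−1}) < c_{k+1}; or (iii) c_k < F(c_{k+2}) < F(c_k) and F(c_{k+1}) < F(c_{k−1}) < c_{k+1}. Suppose further that there exist indices ℓ_0 := k−1 > ℓ_1 > ℓ_2 > … > ℓ_s > ℓ_{s+1} := 0 such that: F(c_{ℓ_j}) = F(c_{k−1}) for 0 ≤ j ≤ s with j ≡ 0 or 1 (mod 4) and F(c_{ℓ_j}) = F(c_{k+2}) for 0 ≤ j ≤ s with j ≡ 2 or 3 (mod 4);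 max_{x∈[c_{ℓ_{j+1}},c_{ℓ_j}]} F(x) = F(c_{k−1}) for 0 ≤ j ≤ s with j ≡ 0, 1 or 3 (mod 4); and min_{x∈[c_{ℓ_{j+1}},c_{ℓ_j}]} F(x) = F(c_{k+2}) for 0 ≤ j ≤ s with j ≡ 1, 2 or 3 (mod 4); and that there exist indices r_0 := k+2 < r_1 < r_2 < … < r_t < r_{t+1} := v+1 such that: F(c_{r_j}) = F(c_{k+2}) for 0 ≤ j ≤ t with j ≡ 0 or 1 (mod 4) and F(c_{r_j}) = F(c_{k−1}) for 0 ≤ j ≤ t with j ≡ 2 or 3 (mod 4); min_{x∈[c_{r_j},c_{r_{j+1}}]} F(x) = F(c_{k+2}) for 0 ≤ j ≤ t with j ≡ 0, 1 or 3 (mod 4); and max_{x∈[c_{r_j},c_{r_{j+1}}]} F(x) = F(c_{k−1}) for 0 ≤ j ≤ t with j ≡ 1, 2 or 3 (mod 4). Then F has a continuous iterative root f of order 2 (f : I → I continuous with f∘f = F) such that f is strictly increasing on [c_k,c_{k+1}] and H(f) = 2. -/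

import Mathlib

open Set Function

noncomputable section

/-- `x` is a fort of `F` on `[a,b]`: `F` is not strictly monotone on any
neighborhood of `x` in `[a,b]`. -/
def IsFort (a b : ℝ) (F : ℝ → ℝ) (x : ℝ) : Prop :=
  x ∈ Set.Icc a b ∧ ∀ ε : ℝ, 0 < ε →
    ¬ StrictMonoOn F (Set.Icc a b ∩ Set.Ioo (x - ε) (x + ε)) ∧
    ¬ StrictAntiOn F (Set.Icc a b ∩ Set.Ioo (x - ε) (x + ε))

/-- The number of forts `N(F)` of `F` on `[a,b]`. -/
noncomputable def nForts (a b : ℝ) (F : ℝ → ℝ) : ℕ :=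
  {x | IsFort a b F x}.ncard

/-- `H(F) = m`: the nonmonotonicity height of `F` on `[a,b]` equals `m`, i.e. `m` is
the least `i ≥ 0` with `N(F^i) = N(F^{i+1})`. -/
def HeightEq (a b : ℝ) (F : ℝ → ℝ) (m : ℕ) : Prop :=
  IsLeast {i : ℕ | nForts a b (F^[i]) = nForts a b (F^[i + 1])} m

/-- `F` is a PM function on `[a,b]` with forts `c 1 < ... < c v`
(`c 0 = a`, `c (v+1) = b`): `F` is continuous, maps `[a,b]` into itself,
is strictly monotone on each lap `[c i, c (i+1)]`, and each `c i`, `1 ≤ i ≤ v`,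
is a fort. -/
structure PMFun (a b : ℝ) (F : ℝ → ℝ) (v : ℕ) (c : ℕ → ℝ) : Prop where
  lt : a < b
  cont : ContinuousOn F (Set.Icc a b)
  maps : Set.MapsTo F (Set.Icc a b) (Set.Icc a b)
  c_zero : c 0 = a
  c_last : c (v + 1) = b
  c_mono : ∀ i ≤ v, c i < c (i + 1)
  lap_mono : ∀ i ≤ v,
    StrictMonoOn F (Set.Icc (c i) (c (i + 1))) ∨ StrictAntiOn F (Set.Icc (c i) (c (i + 1)))
  fort : ∀ i, 1 ≤ i → i ≤ v → IsFort a b F (c i)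

/-- `[d,e]` is a lap of `G` on `[a,b]`: a maximal interval of strict monotonicity,
bounded by forts or the endpoints of `[a,b]`, with no fort inside. -/
def IsLap (a b : ℝ) (G : ℝ → ℝ) (d e : ℝ) : Prop :=
  a ≤ d ∧ d < e ∧ e ≤ b ∧
  (StrictMonoOn G (Set.Icc d e) ∨ StrictAntiOn G (Set.Icc d e)) ∧
  (d = a ∨ IsFort a b G d) ∧ (e = b ∨ IsFort a b G e) ∧
  ∀ x ∈ Set.Ioo d e, ¬ IsFort a b G x

/-- The set of fixed points of `φ` in `[α,β]`. -/
def fixedSet (α β : ℝ) (φ : ℝ → ℝ) : Set ℝ := {x | x ∈ Set.Icc α β ∧ φ x = x}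

/-- `φ` is a reversing-correspondence on `[α,β]`. -/
def RevCorr (α β : ℝ) (φ : ℝ → ℝ) : Prop :=
  StrictMonoOn φ (Set.Icc α β) ∧ ContinuousOn φ (Set.Icc α β) ∧
  Set.MapsTo φ (Set.Icc α β) (Set.Icc α β) ∧
  ∃ ξ ∈ fixedSet α β φ, ∃ ω : ℝ → ℝ,
    Set.MapsTo ω (fixedSet α β φ) (fixedSet α β φ) ∧
    StrictAntiOn ω (fixedSet α β φ) ∧
    Set.SurjOn ω (fixedSet α β φ) (fixedSet α β φ) ∧
    ω ξ = ξ ∧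
    ((α ∈ fixedSet α β φ ∧ β ∈ fixedSet α β φ) ∨
      (α ∉ fixedSet α β φ ∧ β ∉ fixedSet α β φ)) ∧
    (∀ ξ₁ ∈ fixedSet α β φ, ∀ ξ₂ ∈ fixedSet α β φ, ξ₁ < ξ₂ → ξ₂ ≤ ξ →
      (∀ z ∈ Set.Ioo ξ₁ ξ₂, z ∉ fixedSet α β φ) →
      ∀ x ∈ Set.Ioo ξ₁ ξ₂, ∀ y ∈ Set.Ioo (ω ξ₂) (ω ξ₁),
        (φ x - x) * (φ y - y) < 0)

/-- The convex hull of the orbit of `x` under the cyclic group generated by `G`. -/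
def orbitHull (G : ℝ ≃o ℝ) (x : ℝ) : Set ℝ :=
  {y | ∃ i j : ℤ, (G ^ i) x ≤ y ∧ y ≤ (G ^ j) x}

theorem zpow_add_apply (G : ℝ ≃o ℝ) (i j : ℤ) (x : ℝ) :
    (G ^ (i + j)) x = (G ^ i) ((G ^ j) x) := by
  rw [zpow_add, RelIso.mul_apply]

theorem zpow_add_one_apply (G : ℝ ≃o ℝ) (i : ℤ) (x : ℝ) :
    (G ^ (i + 1)) x = G ((G ^ i) x) := by
  rw [add_comm, zpow_add_apply, zpow_one]

theorem zpow_add_one_apply' (G : ℝ ≃o ℝ) (i : ℤ) (x : ℝ) :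
    (G ^ (i + 1)) x = (G ^ i) (G x) := by
  rw [zpow_add_apply, zpow_one]

theorem mem_orbitHull_self (G : ℝ ≃o ℝ) (x : ℝ) : x ∈ orbitHull G x :=
  ⟨0, 0, by simp, by simp⟩

theorem orbitHull_symm {G : ℝ ≃o ℝ} {x y : ℝ} (h : y ∈ orbitHull G x) : x ∈ orbitHull G y := by
  obtain ⟨i, j, hi, hj⟩ := h
  refine ⟨-j, -i, ?_, ?_⟩
  · have := (G ^ (-j)).monotone hj
    rwa [← zpow_add_apply, neg_add_cancel, zpow_zero, RelIso.one_apply] at this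
  · have := (G ^ (-i)).monotone hi
    rwa [← zpow_add_apply, neg_add_cancel, zpow_zero, RelIso.one_apply] at this

theorem orbitHull_trans {G : ℝ ≃o ℝ} {x y z : ℝ} (h : y ∈ orbitHull G x)
    (h' : z ∈ orbitHull G y) : z ∈ orbitHull G x := by
  obtain ⟨i, j, hi, hj⟩ := h
  obtain ⟨i', j', hi', hj'⟩ := h'
  refine ⟨i' + i, j' + j, ?_, ?_⟩
  · rw [zpow_add_apply]
    exact ((G ^ i').monotone hi).trans hi'
  · rw [zpow_add_apply]
    exact hj'.trans ((G ^ j').monotone hj)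

theorem orbitHull_eq {G : ℝ ≃o ℝ} {x y : ℝ} (h : y ∈ orbitHull G x) :
    orbitHull G y = orbitHull G x :=
  Set.ext fun _ => ⟨orbitHull_trans h, orbitHull_trans (orbitHull_symm h)⟩

theorem apply_mem_orbitHull {G : ℝ ≃o ℝ} {x y : ℝ} (h : y ∈ orbitHull G x) :
    G y ∈ orbitHull G x :=
  orbitHull_trans h ⟨1, 1, by simp, by simp⟩

theorem orbitHull_inv (G : ℝ ≃o ℝ) (x : ℝ) : orbitHull G⁻¹ x = orbitHull G x := by
  ext y
  constructor
  · rintro ⟨i, j, hi, hj⟩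
    exact ⟨-i, -j, by simpa using hi, by simpa using hj⟩
  · rintro ⟨i, j, hi, hj⟩
    exact ⟨-i, -j, by simpa using hi, by simpa using hj⟩

theorem orbitHull_ordConnected {G : ℝ ≃o ℝ} {x y z w : ℝ} (hy : y ∈ orbitHull G x)
    (hz : z ∈ orbitHull G x) (h₁ : y ≤ w) (h₂ : w ≤ z) : w ∈ orbitHull G x := by
  obtain ⟨i, -, hi, -⟩ := hy
  obtain ⟨-, j, -, hj⟩ := hz
  exact ⟨i, j, hi.trans h₁, h₂.trans hj⟩

theorem lt_of_orbitHull_ne {G : ℝ ≃o ℝ} {x w y z : ℝ} (hne : orbitHull G x ≠ orbitHull G w)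
    (hxw : x < w) (hy : y ∈ orbitHull G x) (hz : z ∈ orbitHull G w) : y < z := by
  by_contra! hzy
  apply hne
  rcases le_total z x with h | h
  · exact orbitHull_eq (orbitHull_ordConnected hz (mem_orbitHull_self G w) h hxw.le)
  · have := orbitHull_ordConnected (mem_orbitHull_self G x) hy h hzy
    rw [← orbitHull_eq this, orbitHull_eq hz]

theorem zpow_apply_strictMono {G : ℝ ≃o ℝ} {x : ℝ} (h : x < G x) :
    StrictMono fun n : ℤ => (G ^ n) x :=
  strictMono_int_of_lt_succ fun n => by
    rw [zpow_add_one_apply']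
    exact (G ^ n).strictMono h

theorem exists_zpow_le_lt {G : ℝ ≃o ℝ} {x y : ℝ} (h : x < G x) (hy : y ∈ orbitHull G x) :
    ∃ n : ℤ, (G ^ n) x ≤ y ∧ y < (G ^ (n + 1)) x := by
  obtain ⟨i, j, hi, hj⟩ := hy
  obtain ⟨n, hn, hmax⟩ := Int.exists_greatest_of_bdd (P := fun n : ℤ => (G ^ n) x ≤ y)
    ⟨j, fun z hz => (zpow_apply_strictMono h).le_iff_le.1 (hz.trans hj)⟩ ⟨i, hi⟩
  refine ⟨n, hn, ?_⟩
  by_contra! hlt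
  have := hmax (n + 1) hlt
  omega

theorem lt_apply_of_mem_orbitHull {G : ℝ ≃o ℝ} {x y : ℝ} (h : x < G x)
    (hy : y ∈ orbitHull G x) : y < G y := by
  obtain ⟨n, hn, hlt⟩ := exists_zpow_le_lt h hy
  rw [zpow_add_one_apply] at hlt
  exact hlt.trans_le (G.monotone hn)

theorem eq_of_mem_orbitHull_of_fixed {G : ℝ ≃o ℝ} {x y : ℝ} (h : G x = x)
    (hy : y ∈ orbitHull G x) : y = x := by
  have hz : ∀ n : ℤ, (G ^ n) x = x := by
    intro n
    induction n with
    | zero => simp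
    | succ n ih => rw [zpow_add_one_apply', h, ih]
    | pred n ih =>
      have := zpow_add_one_apply' G (-(n : ℤ) - 1) x
      rw [sub_add_cancel, ih, h] at this
      exact this.symm
  obtain ⟨i, j, hi, hj⟩ := hy
  rw [hz] at hi hj
  exact le_antisymm hj hi

/-- A square root of `G` on the orbit hull of `x₀` sending `x₀` to `x₁`. -/
def IsHullRoot (G : ℝ ≃o ℝ) (x₀ x₁ : ℝ) (g : ℝ → ℝ) : Prop :=
  StrictMonoOn g (orbitHull G x₀) ∧ MapsTo g (orbitHull G x₀) (orbitHull G x₀) ∧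
    (∀ y ∈ orbitHull G x₀, g (g y) = G y) ∧ g x₀ = x₁

theorem exists_hullRoot_of_lt {G : ℝ ≃o ℝ} {x₀ x₁ : ℝ} (h₀ : x₀ < x₁) (h₁ : x₁ < G x₀) :
    ∃ g, IsHullRoot G x₀ x₁ g := by
  have hG : x₀ < G x₀ := h₀.trans h₁
  set φ : ℝ → ℝ := fun t => x₀ + (x₁ - x₀) * min (2 * t) 1 + (G x₀ - x₁) * max (2 * t - 1) 0
    with hφ
  have hφc : Continuous φ := by fun_prop
  have hφm : StrictMono φ := by
    intro s t hst
    simp only [hφ]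
    rcases le_total (2 * s) 1 with hs | hs <;> rcases le_total (2 * t) 1 with ht | ht
    · rw [min_eq_left hs, min_eq_left ht, max_eq_right (by linarith), max_eq_right (by linarith)]
      nlinarith
    · rw [min_eq_left hs, min_eq_right ht, max_eq_right (by linarith), max_eq_left (by linarith)]
      rcases hs.lt_or_eq with hs' | hs' <;> nlinarith
    · linarith
    · rw [min_eq_right hs, min_eq_right ht, max_eq_left (by linarith), max_eq_left (by linarith)]
      nlinarith
  have φ0 : φ 0 = x₀ := by simp [hφ]
  have φh : φ (1 / 2) = x₁ := by simp [hφ]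
  have φ1 : φ 1 = G x₀ := by norm_num [hφ]
  set H : ℝ → ℝ := fun t => (G ^ ⌊t⌋) (φ (Int.fract t)) with hH
  have hlow : ∀ t, (G ^ ⌊t⌋) x₀ ≤ H t := fun t =>
    (G ^ ⌊t⌋).monotone (φ0 ▸ hφm.monotone (Int.fract_nonneg t))
  have hupp : ∀ t, H t < (G ^ (⌊t⌋ + 1)) x₀ := fun t => by
    rw [zpow_add_one_apply']
    exact (G ^ ⌊t⌋).strictMono (φ1 ▸ hφm (Int.fract_lt_one t))
  have hmono : StrictMono H := by
    intro s t hst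
    rcases (Int.floor_mono hst.le).lt_or_eq with h | h
    · exact (hupp s).trans_le
        (((zpow_apply_strictMono hG).monotone (Int.add_one_le_iff.2 h)).trans (hlow t))
    · simp only [hH]
      rw [h]
      refine (G ^ ⌊t⌋).strictMono (hφm ?_)
      rw [Int.fract, Int.fract, h]
      linarith
  have hmem : ∀ t, H t ∈ orbitHull G x₀ := fun t => ⟨_, _, hlow t, (hupp t).le⟩
  have hadd : ∀ t, H (t + 1) = G (H t) := fun t => by
    simp only [hH]
    rw [Int.floor_add_one, Int.fract_add_one, zpow_add_one_apply]
  have hsurj : ∀ y ∈ orbitHull G x₀, ∃ t, H t = y := by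
    intro y hy
    obtain ⟨n, hn, hlt⟩ := exists_zpow_le_lt hG hy
    rw [zpow_add_one_apply'] at hlt
    have hy' : (G ^ n).symm y ∈ Ico (φ 0) (φ 1) := by
      rw [φ0, φ1]
      exact ⟨(OrderIso.le_symm_apply _).2 hn, (OrderIso.symm_apply_lt _).2 hlt⟩
    obtain ⟨u, hu, huy⟩ := intermediate_value_Ico zero_le_one hφc.continuousOn hy'
    refine ⟨n + u, ?_⟩
    have hfl : ⌊(n : ℝ) + u⌋ = n := by
      rw [Int.floor_intCast_add, Int.floor_eq_zero_iff.2 hu, add_zero]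
    simp only [hH]
    rw [hfl, Int.fract_intCast_add, Int.fract_eq_self.2 hu, huy, OrderIso.apply_symm_apply]
  have hinv : ∀ t, invFun H (H t) = t := leftInverse_invFun hmono.injective
  refine ⟨fun y => H (invFun H y + 1 / 2), ?_, fun y _ => hmem _, ?_, ?_⟩
  · intro y hy z hz hyz
    obtain ⟨s, rfl⟩ := hsurj y hy
    obtain ⟨t, rfl⟩ := hsurj z hz
    simp only [hinv]
    exact hmono (by linarith [hmono.lt_iff_lt.1 hyz])
  · intro y hy
    obtain ⟨s, rfl⟩ := hsurj y hy
    simp only [hinv]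
    rw [← hadd]
    congr 1
    ring
  · have h0 : H 0 = x₀ := by simp [hH, φ0]
    have hh : H (1 / 2) = x₁ := by
      have h1 : ⌊(1 / 2 : ℝ)⌋ = 0 := by norm_num
      have h2 : Int.fract (1 / 2 : ℝ) = 1 / 2 := by rw [Int.fract, h1]; simp
      simp only [hH]
      rw [h1, h2, φh]
      simp
    have := hinv 0
    rw [h0] at this
    simp only [this, zero_add, hh]

theorem exists_hullRoot_of_gt {G : ℝ ≃o ℝ} {x₀ x₁ : ℝ} (h₀ : x₁ < x₀) (h₁ : G x₀ < x₁) :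
    ∃ g, IsHullRoot G x₀ x₁ g := by
  have hx₁ : x₁ ∈ orbitHull G x₀ := ⟨1, 0, by simpa using h₁.le, by simpa using h₀.le⟩
  obtain ⟨g, hg, hgm, hgg, hgx⟩ :=
    exists_hullRoot_of_lt (G := G⁻¹) h₀ (G.lt_symm_apply.2 h₁)
  rw [orbitHull_inv, orbitHull_eq hx₁] at hg hgm hgg
  have hcomm : ∀ z ∈ orbitHull G x₀, g (G z) = G (g z) := by
    intro z hz
    have h1 := hgg _ (hgm (apply_mem_orbitHull hz))
    rw [hgg _ (apply_mem_orbitHull hz), RelIso.inv_apply_self] at h1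
    rw [h1, RelIso.apply_inv_self]
  refine ⟨fun y => G (g y), ?_, fun y hy => apply_mem_orbitHull (hgm hy), ?_, ?_⟩
  · exact fun y hy z hz hyz => G.strictMono (hg hy hz hyz)
  · intro y hy
    simp only
    rw [hcomm _ (hgm hy), hgg _ hy, RelIso.apply_inv_self]
  · simp only
    rw [← hgx, hgg _ hx₁, RelIso.apply_inv_self]

/-- `y` is a possible value at `x` of a square root of `G`. -/
def Admissible (G : ℝ ≃o ℝ) (x y : ℝ) : Prop :=
  (x < y ∧ y < G x) ∨ (x = y ∧ y = G x) ∨ (G x < y ∧ y < x)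

theorem Admissible.exists_hullRoot {G : ℝ ≃o ℝ} {x₀ x₁ : ℝ} (h : Admissible G x₀ x₁) :
    ∃ g, IsHullRoot G x₀ x₁ g := by
  rcases h with h | h | h
  · exact exists_hullRoot_of_lt h.1 h.2
  · have hfix : G x₀ = x₀ := by rw [← h.2, h.1]
    refine ⟨id, fun _ _ _ _ h => h, fun _ h => h, ?_, h.1⟩
    intro y hy
    rw [eq_of_mem_orbitHull_of_fixed hfix hy, hfix]
    rfl
  · exact exists_hullRoot_of_gt h.2 h.1

theorem exists_admissible (G : ℝ ≃o ℝ) (x : ℝ) : ∃ y, Admissible G x y := by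
  rcases lt_trichotomy x (G x) with h | h | h
  · obtain ⟨y, hy⟩ := exists_between h
    exact ⟨y, Or.inl hy⟩
  · exact ⟨x, Or.inr (Or.inl ⟨rfl, h⟩)⟩
  · obtain ⟨y, hy⟩ := exists_between h
    exact ⟨y, Or.inr (Or.inr hy)⟩

/-- Square roots chosen on the orbit hulls of `G` glue to a square root on the line. -/
theorem exists_orderIso_root {G : ℝ ≃o ℝ} {α β m M : ℝ}
    (hα : Admissible G α m) (hβ : Admissible G β M) (hne : orbitHull G α ≠ orbitHull G β) :
    ∃ φ : ℝ ≃o ℝ, (∀ x, φ (φ x) = G x) ∧ φ α = m ∧ φ β = M := by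
  have key : ∀ S : Set ℝ, ∃ g : ℝ → ℝ, (∃ x, S = orbitHull G x) →
      StrictMonoOn g S ∧ MapsTo g S S ∧ (∀ y ∈ S, g (g y) = G y) ∧
        (S = orbitHull G α → g α = m) ∧ (S = orbitHull G β → g β = M) := by
    intro S
    by_cases hS : ∃ x, S = orbitHull G x
    swap
    · exact ⟨id, fun h => absurd h hS⟩
    by_cases hSα : S = orbitHull G α
    · subst hSα
      obtain ⟨g, h1, h2, h3, h4⟩ := hα.exists_hullRoot
      exact ⟨g, fun _ => ⟨h1, h2, h3, fun _ => h4, fun h => absurd h hne⟩⟩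
    by_cases hSβ : S = orbitHull G β
    · subst hSβ
      obtain ⟨g, h1, h2, h3, h4⟩ := hβ.exists_hullRoot
      exact ⟨g, fun _ => ⟨h1, h2, h3, fun h => absurd h hSα, fun _ => h4⟩⟩
    obtain ⟨x, rfl⟩ := hS
    obtain ⟨y, hy⟩ := exists_admissible G x
    obtain ⟨g, h1, h2, h3, -⟩ := hy.exists_hullRoot
    exact ⟨g, fun _ => ⟨h1, h2, h3, fun h => absurd h hSα, fun h => absurd h hSβ⟩⟩
  choose g hg using key
  have hg' := fun x => hg (orbitHull G x) ⟨x, rfl⟩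
  set f : ℝ → ℝ := fun x => g (orbitHull G x) x with hf
  have hfm : ∀ x, f x ∈ orbitHull G x := fun x => (hg' x).2.1 (mem_orbitHull_self G x)
  have hff : ∀ x, f (f x) = G x := by
    intro x
    have h1 : f (f x) = g (orbitHull G x) (f x) := by
      show g (orbitHull G (f x)) (f x) = _
      rw [orbitHull_eq (hfm x)]
    rw [h1]
    exact (hg' x).2.2.1 x (mem_orbitHull_self G x)
  have hmono : StrictMono f := by
    intro x y hxy
    by_cases h : orbitHull G x = orbitHull G y
    · simp only [hf]
      rw [← h]
      exact (hg' x).1 (mem_orbitHull_self G x) (h ▸ mem_orbitHull_self G y) hxy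
    · exact lt_of_orbitHull_ne h hxy (hfm x) (hfm y)
  have hsurj : Surjective f := fun y => ⟨f (G.symm y), by rw [hff, G.apply_symm_apply]⟩
  exact ⟨hmono.orderIsoOfSurjective f hsurj, hff, (hg' α).2.2.2.1 rfl, (hg' β).2.2.2.2 rfl⟩

/-- A continuous strictly increasing function on `[p, q]` extends to an order isomorphism of the
line. -/
theorem exists_orderIso_extension {p q : ℝ} {F : ℝ → ℝ} (hpq : p ≤ q)
    (hc : ContinuousOn F (Icc p q)) (hF : StrictMonoOn F (Icc p q)) :
    ∃ G : ℝ ≃o ℝ, ∀ x ∈ Icc p q, G x = F x := by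
  set κ : ℝ → ℝ := fun x => max p (min q x) with hκ
  have hκm : ∀ x, κ x ∈ Icc p q := fun x => ⟨le_max_left _ _, max_le hpq (min_le_left _ _)⟩
  have hκc : Continuous κ := by fun_prop
  have hκid : ∀ x ∈ Icc p q, κ x = x := fun x hx => by
    simp only [hκ]
    rw [min_eq_right hx.2, max_eq_right hx.1]
  have hκ1 : ∀ x y, x ≤ y → κ x ≤ κ y ∧ κ y - κ x ≤ y - x := by
    intro x y hxy
    simp only [hκ]
    constructor
    · gcongr
    · rcases max_cases p (min q x) with h1 | h1 <;> rcases max_cases p (min q y) with h2 | h2 <;>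
        rcases min_cases q x with h3 | h3 <;> rcases min_cases q y with h4 | h4 <;> linarith
  set G : ℝ → ℝ := fun x => F (κ x) + (x - κ x) with hG
  have hGc : Continuous G :=
    (hc.comp_continuous hκc hκm).add (continuous_id.sub hκc)
  have hGm : StrictMono G := by
    intro x y hxy
    simp only [hG]
    obtain ⟨h1, h2⟩ := hκ1 x y hxy.le
    rcases h1.lt_or_eq with h | h
    · linarith [hF (hκm x) (hκm y) h]
    · rw [h]
      linarith
  have hbd : ∀ x, F p ≤ F (κ x) ∧ F (κ x) ≤ F q := fun x =>
    ⟨hF.monotoneOn (left_mem_Icc.2 hpq) (hκm x) (hκm x).1,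
      hF.monotoneOn (hκm x) (right_mem_Icc.2 hpq) (hκm x).2⟩
  have htop : Filter.Tendsto G Filter.atTop Filter.atTop := by
    refine Filter.tendsto_atTop_mono (f := fun x => (F p - q) + x) (fun x => ?_)
      (Filter.tendsto_atTop_add_const_left _ _ Filter.tendsto_id)
    simp only [hG]
    linarith [hbd x, (hκm x).2]
  have hbot : Filter.Tendsto G Filter.atBot Filter.atBot := by
    refine Filter.tendsto_atBot_mono (f := fun x => (F q - p) + x) (fun x => ?_)
      (Filter.tendsto_atBot_add_const_left _ _ Filter.tendsto_id)
    simp only [hG]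
    linarith [hbd x, (hκm x).1]
  refine ⟨hGm.orderIsoOfSurjective G (hGc.surjective htop hbot), fun x hx => ?_⟩
  simp [hG, hκid x hx]

/-- Data for building a square root: on each of three closed sets covering `[a, b]` a different
inverse branch of the root is used. -/
theorem exists_root_of_cover {a b p α β q m M : ℝ} {F : ℝ → ℝ} {S R L : Set ℝ}
    (hS : IsClosed S) (hR : IsClosed R) (hL : IsClosed L)
    (hcov : Icc a b ⊆ S ∪ (R ∪ L)) (hSsub : Icc p q ⊆ S)
    (hpα : p < α) (hαβ : α < β) (hβq : β < q) (hpq : Icc p q ⊆ Icc a b)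
    (hc : ContinuousOn F (Icc a b)) (hmaps : MapsTo F (Icc a b) (Icc α β))
    (hFp : StrictAntiOn F (Icc p α)) (hFm : StrictMonoOn F (Icc α β))
    (hFq : StrictAntiOn F (Icc β q)) (hM : F p = M) (hm : F q = m)
    (hα : (α < m ∧ m < F α) ∨ (α = m ∧ m = F α))
    (hβ : (F β < M ∧ M < β) ∨ (M = β ∧ F β = M))
    (hSR : ∀ x ∈ S, x ∈ R → F x = M) (hSL : ∀ x ∈ S, x ∈ L → F x = m) (hRL : Disjoint R L)
    (hFS : ∀ x ∈ S, m ≤ F x ∧ F x ≤ M) (hFR : ∀ x ∈ R, F x ≤ M) (hFL : ∀ x ∈ L, m ≤ F x) :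
    ∃ f ψ e : ℝ → ℝ, ContinuousOn f (Icc a b) ∧ MapsTo f (Icc a b) (Icc a b) ∧
      (∀ x ∈ Icc a b, f (f x) = F x) ∧ StrictMono ψ ∧ StrictAnti e ∧
      (∀ x ∈ S, f x = ψ (F x)) ∧ (∀ x ∈ R, f x = e (F x)) := by
  have sub1 : Icc p α ⊆ Icc a b := (Icc_subset_Icc_right (by linarith)).trans hpq
  have sub2 : Icc α β ⊆ Icc a b := (Icc_subset_Icc hpα.le hβq.le).trans hpq
  have sub3 : Icc β q ⊆ Icc a b := (Icc_subset_Icc_left (by linarith)).trans hpq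
  obtain ⟨G, hG⟩ := exists_orderIso_extension hαβ.le (hc.mono sub2) hFm
  obtain ⟨KL, hKL⟩ := exists_orderIso_extension hpα.le (hc.mono sub1).neg hFp.neg
  obtain ⟨KR, hKR⟩ := exists_orderIso_extension hβq.le (hc.mono sub3).neg hFq.neg
  have hGα := hG α ⟨le_rfl, hαβ.le⟩
  have hGβ := hG β ⟨hαβ.le, le_rfl⟩
  have hKLp := hKL p ⟨le_rfl, hpα.le⟩
  have hKLα := hKL α ⟨hpα.le, le_rfl⟩
  have hKRβ := hKR β ⟨le_rfl, hβq.le⟩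
  have hKRq := hKR q ⟨hβq.le, le_rfl⟩
  simp only [Pi.neg_apply] at hKLp hKLα hKRβ hKRq
  have hαm : α ≤ m := by rcases hα with h | h <;> linarith
  have hMβ : M ≤ β := by rcases hβ with h | h <;> linarith
  have hmM : m ≤ M := by
    have := hFS p (hSsub ⟨le_rfl, by linarith⟩)
    linarith
  obtain ⟨φ, hφφ, hφα, hφβ⟩ : ∃ φ : ℝ ≃o ℝ, (∀ x, φ (φ x) = G x) ∧ φ α = m ∧ φ β = M := by
    apply exists_orderIso_root
    · rw [Admissible, hGα]
      tauto
    · rw [Admissible, hGβ]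
      rcases hβ with h | ⟨h1, h2⟩
      · exact Or.inr (Or.inr h)
      · exact Or.inr (Or.inl ⟨h1.symm, h2.symm⟩)
    · intro heq
      have hmem : β ∈ orbitHull G α := heq ▸ mem_orbitHull_self G β
      rcases hα with h | h
      · have := lt_apply_of_mem_orbitHull (hGα ▸ h.1.trans h.2) hmem
        rw [hGβ] at this
        rcases hβ with h' | h' <;> linarith
      · have := eq_of_mem_orbitHull_of_fixed (by rw [hGα]; linarith) hmem
        linarith
  have hφG : ∀ x ∈ Icc α β, φ (φ x) = F x := fun x hx => by rw [hφφ, hG x hx]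
  have hφm : φ m = F α := by rw [← hφα, hφG α ⟨le_rfl, hαβ.le⟩]
  have hφM : φ M = F β := by rw [← hφβ, hφG β ⟨hαβ.le, le_rfl⟩]
  set ψ : ℝ → ℝ := ⇑φ.symm with hψ
  set eR : ℝ → ℝ := fun y => KR.symm (-φ y) with heR
  set eL : ℝ → ℝ := fun y => KL.symm (-φ y) with heL
  have hψm : ψ m = α := by rw [hψ, ← hφα, φ.symm_apply_apply]
  have hψM : ψ M = β := by rw [hψ, ← hφβ, φ.symm_apply_apply]
  have heRM : eR M = β := by simp only [heR]; rw [hφM, ← hKRβ, KR.symm_apply_apply]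
  have heRα : eR α = q := by simp only [heR]; rw [hφα, ← hm, ← hKRq, KR.symm_apply_apply]
  have heLm : eL m = α := by simp only [heL]; rw [hφm, ← hKLα, KL.symm_apply_apply]
  have heLβ : eL β = p := by simp only [heL]; rw [hφβ, ← hM, ← hKLp, KL.symm_apply_apply]
  have hψmono : StrictMono ψ := φ.symm.strictMono
  have heRanti : StrictAnti eR := fun x y h => KR.symm.strictMono (neg_lt_neg (φ.strictMono h))
  have heLanti : StrictAnti eL := fun x y h => KL.symm.strictMono (neg_lt_neg (φ.strictMono h))
  have hψc : Continuous ψ := φ.symm.continuous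
  have heRc : Continuous eR := KR.symm.continuous.comp φ.continuous.neg
  have heLc : Continuous eL := KL.symm.continuous.comp φ.continuous.neg
  classical
  set f : ℝ → ℝ := fun x => if x ∈ R then eR (F x) else if x ∈ L then eL (F x) else ψ (F x)
    with hf
  have fR : ∀ x ∈ R, f x = eR (F x) := fun x hx => if_pos hx
  have fL : ∀ x ∈ L, f x = eL (F x) := fun x hx => by
    simp only [hf]
    rw [if_neg (fun h => hRL.le_bot ⟨h, hx⟩), if_pos hx]
  have fS : ∀ x ∈ S, f x = ψ (F x) := fun x hx => by
    by_cases h1 : x ∈ R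
    · rw [fR x h1, hSR x hx h1, heRM, hψM]
    by_cases h2 : x ∈ L
    · rw [fL x h2, hSL x hx h2, heLm, hψm]
    simp only [hf]
    rw [if_neg h1, if_neg h2]
  have ψmem : ∀ x ∈ S, ψ (F x) ∈ Icc α β := fun x hx =>
    ⟨hψm ▸ hψmono.monotone (hFS x hx).1, hψM ▸ hψmono.monotone (hFS x hx).2⟩
  have eRmem : ∀ x ∈ Icc a b, x ∈ R → eR (F x) ∈ Icc β q := fun x hx hxR =>
    ⟨heRM ▸ heRanti.antitone (hFR x hxR), heRα ▸ heRanti.antitone (hmaps hx).1⟩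
  have eLmem : ∀ x ∈ Icc a b, x ∈ L → eL (F x) ∈ Icc p α := fun x hx hxL =>
    ⟨heLβ ▸ heLanti.antitone (hmaps hx).2, heLm ▸ heLanti.antitone (hFL x hxL)⟩
  have hfpq : MapsTo f (Icc a b) (Icc p q) := by
    intro x hx
    rcases hcov hx with h | h | h
    · rw [fS x h]
      exact Icc_subset_Icc hpα.le hβq.le (ψmem x h)
    · rw [fR x h]
      exact Icc_subset_Icc_left (by linarith) (eRmem x hx h)
    · rw [fL x h]
      exact Icc_subset_Icc_right (by linarith) (eLmem x hx h)
  refine ⟨f, ψ, eR, ?_, fun x hx => hpq (hfpq hx), ?_, hψmono, heRanti, fS, fR⟩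
  · have c1 : ContinuousOn f (Icc a b ∩ S) :=
      (hψc.comp_continuousOn (hc.mono inter_subset_left)).congr fun x hx => fS x hx.2
    have c2 : ContinuousOn f (Icc a b ∩ R) :=
      (heRc.comp_continuousOn (hc.mono inter_subset_left)).congr fun x hx => fR x hx.2
    have c3 : ContinuousOn f (Icc a b ∩ L) :=
      (heLc.comp_continuousOn (hc.mono inter_subset_left)).congr fun x hx => fL x hx.2
    have c4 := c1.union_of_isClosed (c2.union_of_isClosed c3 (isClosed_Icc.inter hR)
      (isClosed_Icc.inter hL)) (isClosed_Icc.inter hS)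
      ((isClosed_Icc.inter hR).union (isClosed_Icc.inter hL))
    refine c4.mono fun x hx => ?_
    rcases hcov hx with h | h | h
    · exact Or.inl ⟨hx, h⟩
    · exact Or.inr (Or.inl ⟨hx, h⟩)
    · exact Or.inr (Or.inr ⟨hx, h⟩)
  · intro x hx
    rw [fS _ (hSsub (hfpq hx)), hψ, OrderIso.symm_apply_eq]
    rcases hcov hx with h | h | h
    · rw [fS x h, ← hφG _ (ψmem x h), hψ, φ.apply_symm_apply]
    · have := hKR _ (eRmem x hx h)
      simp only [Pi.neg_apply] at this
      rw [fR x h, ← neg_neg (F (eR (F x))), ← this]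
      simp [heR]
    · have := hKL _ (eLmem x hx h)
      simp only [Pi.neg_apply] at this
      rw [fL x h, ← neg_neg (F (eL (F x))), ← this]
      simp [heL]

/-- A fort of `f` separating a decreasing piece from an increasing one. -/
theorem isFort_of_anti_of_mono {a b p x q : ℝ} {f : ℝ → ℝ} (hpx : p < x) (hxq : x < q)
    (hsub : Icc p q ⊆ Icc a b) (h₁ : StrictAntiOn f (Icc p x)) (h₂ : StrictMonoOn f (Icc x q)) :
    IsFort a b f x := by
  refine ⟨hsub ⟨hpx.le, hxq.le⟩, fun ε hε => ⟨fun h => ?_, fun h => ?_⟩⟩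
  · obtain ⟨y, hy1, hy2⟩ := exists_between (max_lt hpx (sub_lt_self x hε))
    have hy := max_lt_iff.1 hy1
    have e1 := h₁ ⟨hy.1.le, hy2.le⟩ ⟨hpx.le, le_rfl⟩ hy2
    have e2 := h ⟨hsub ⟨hy.1.le, by linarith⟩, hy.2, by linarith⟩
      ⟨hsub ⟨hpx.le, hxq.le⟩, by linarith, by linarith⟩ hy2
    linarith
  · obtain ⟨y, hy1, hy2⟩ := exists_between (lt_min hxq (lt_add_of_pos_right x hε))
    have hy := lt_min_iff.1 hy2
    have e1 := h₂ ⟨le_rfl, hxq.le⟩ ⟨hy1.le, hy.1.le⟩ hy1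
    have e2 := h ⟨hsub ⟨hpx.le, hxq.le⟩, by linarith, by linarith⟩
      ⟨hsub ⟨by linarith, hy.1.le⟩, by linarith, hy.2⟩ hy1
    linarith

theorem not_isFort_of_strictMonoOn_or_strictAntiOn {a b d x e : ℝ} {f : ℝ → ℝ} (hd : d < x)
    (he : x < e) (h : StrictMonoOn f (Icc d e) ∨ StrictAntiOn f (Icc d e)) :
    ¬ IsFort a b f x := by
  rintro ⟨-, hx⟩
  obtain ⟨h₁, h₂⟩ := hx (min (x - d) (e - x)) (lt_min (by linarith) (by linarith))
  have hsub : Icc a b ∩ Ioo (x - min (x - d) (e - x)) (x + min (x - d) (e - x)) ⊆ Icc d e := by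
    rintro y ⟨-, hy1, hy2⟩
    have := min_le_left (x - d) (e - x)
    have := min_le_right (x - d) (e - x)
    exact ⟨by linarith, by linarith⟩
  rcases h with h | h
  · exact h₁ (h.mono hsub)
  · exact h₂ (h.mono hsub)

/-- An inner factor inherits the non-forts of a composition. -/
theorem IsFort.of_comp_eq {a b x : ℝ} {f F : ℝ → ℝ} (hf : ContinuousOn f (Icc a b))
    (hff : ∀ x ∈ Icc a b, f (f x) = F x) (h : IsFort a b f x) : IsFort a b F x := by
  have hxab := h.1
  refine ⟨hxab, fun ε hε => ?_⟩
  by_contra hcon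
  set S := Icc a b ∩ Ioo (x - ε) (x + ε) with hS
  have hinj : InjOn F S := by
    by_cases h1 : StrictMonoOn F S
    · exact h1.injOn
    · exact (not_not.1 fun h2 => hcon ⟨h1, h2⟩ : StrictAntiOn F S).injOn
  have hsub : Icc (max a (x - ε / 2)) (min b (x + ε / 2)) ⊆ S := by
    rintro y ⟨hy1, hy2⟩
    have := max_le_iff.1 hy1
    have := le_min_iff.1 hy2
    exact ⟨⟨by linarith, by linarith⟩, by linarith, by linarith⟩
  have hinj' : InjOn f (Icc (max a (x - ε / 2)) (min b (x + ε / 2))) := by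
    intro y hy z hz hyz
    apply hinj (hsub hy) (hsub hz)
    rw [← hff y (hsub hy).1, ← hff z (hsub hz).1, hyz]
  have hle : max a (x - ε / 2) ≤ min b (x + ε / 2) :=
    (max_le hxab.1 (by linarith)).trans (le_min hxab.2 (by linarith))
  have hsub' : Icc a b ∩ Ioo (x - ε / 2) (x + ε / 2) ⊆
      Icc (max a (x - ε / 2)) (min b (x + ε / 2)) := fun y hy =>
    ⟨max_le hy.1.1 hy.2.1.le, le_min hy.1.2 hy.2.2.le⟩
  obtain ⟨n1, n2⟩ := h.2 (ε / 2) (by linarith)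
  rcases ContinuousOn.strictMonoOn_of_injOn_Icc' hle
    (hf.mono fun y hy => (hsub hy).1) hinj' with h1 | h1
  · exact n1 (h1.mono hsub')
  · exact n2 (h1.mono hsub')

theorem strictMonoOn_comp_iff {f g : ℝ → ℝ} {S T : Set ℝ} (hf : StrictMonoOn f T)
    (hg : MapsTo g S T) : StrictMonoOn (f ∘ g) S ↔ StrictMonoOn g S :=
  ⟨fun h _ hx _ hy hxy => (hf.lt_iff_lt (hg hx) (hg hy)).1 (h hx hy hxy),
    fun h => hf.comp h hg⟩

theorem strictAntiOn_comp_iff {f g : ℝ → ℝ} {S T : Set ℝ} (hf : StrictMonoOn f T)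
    (hg : MapsTo g S T) : StrictAntiOn (f ∘ g) S ↔ StrictAntiOn g S :=
  ⟨fun h _ hx _ hy hxy => (hf.lt_iff_lt (hg hy) (hg hx)).1 (h hx hy hxy),
    fun h => hf.comp_strictAntiOn h hg⟩

theorem isFort_comp_iff {a b x : ℝ} {f F : ℝ → ℝ} {T : Set ℝ} (hf : StrictMonoOn f T)
    (hF : MapsTo F (Icc a b) T) : IsFort a b (f ∘ F) x ↔ IsFort a b F x := by
  simp only [IsFort]
  refine and_congr_right fun _ => forall₂_congr fun ε _ => ?_
  rw [strictMonoOn_comp_iff hf (hF.mono_left inter_subset_left),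
    strictAntiOn_comp_iff hf (hF.mono_left inter_subset_left)]

theorem isFort_congr {a b x : ℝ} {f g : ℝ → ℝ} (h : EqOn f g (Icc a b)) :
    IsFort a b f x ↔ IsFort a b g x := by
  simp only [IsFort]
  refine and_congr_right fun _ => forall₂_congr fun ε _ => ?_
  have h' := h.mono (inter_subset_left (t := Ioo (x - ε) (x + ε)))
  rw [h'.congr_strictMonoOn, h'.congr_strictAntiOn]

theorem nForts_id (a b : ℝ) : nForts a b id = 0 := by
  have : {x | IsFort a b id x} = ∅ :=
    eq_empty_of_forall_notMem fun x hx => (hx.2 1 one_pos).1 (strictMono_id.strictMonoOn _)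
  rw [nForts, this, ncard_empty]

/-- A root of order two of `F` that loses a fort has height two. -/
theorem heightEq_two {a b x y : ℝ} {f F : ℝ → ℝ} {T : Set ℝ} (hf : ContinuousOn f (Icc a b))
    (hff : ∀ x ∈ Icc a b, f (f x) = F x) (hfin : {x | IsFort a b F x}.Finite)
    (hT : StrictMonoOn f T) (hF : MapsTo F (Icc a b) T)
    (hx : IsFort a b f x) (hy : IsFort a b F y) (hy' : ¬ IsFort a b f y) :
    HeightEq a b f 2 := by
  have h2 : nForts a b f^[2] = nForts a b F := by
    rw [nForts, nForts]
    congr 1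
    ext z
    exact isFort_congr hff
  have h3 : nForts a b f^[3] = nForts a b F := by
    rw [nForts, nForts]
    congr 1
    ext z
    rw [mem_ofPred_eq, mem_ofPred_eq, ← isFort_comp_iff hT hF]
    exact isFort_congr fun w hw => congrArg f (hff w hw)
  have hsub : {x | IsFort a b f x} ⊆ {x | IsFort a b F x} := fun z hz =>
    IsFort.of_comp_eq hf hff hz
  refine ⟨h2.trans h3.symm, fun i hi => ?_⟩
  by_contra! hlt
  interval_cases i
  · have h0 : nForts a b f = 0 := by
      rw [mem_ofPred_eq, iterate_zero, nForts_id, iterate_succ, iterate_zero, id_comp] at hi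
      exact hi.symm
    rw [nForts, ncard_eq_zero (hfin.subset hsub)] at h0
    exact h0.le hx
  · have h1 : nForts a b f = nForts a b F := by
      rw [← h2]
      exact hi
    exact (ncard_lt_ncard ⟨hsub, fun h => hy' (h hy)⟩ hfin).ne h1

theorem le_of_le_succ {γ : Type*} [Preorder γ] {g : ℕ → γ} {n : ℕ}
    (h : ∀ j ≤ n, g j ≤ g (j + 1)) {i j : ℕ} (hij : i ≤ j) (hj : j ≤ n + 1) : g i ≤ g j := by
  induction j, hij using Nat.le_induction with
  | base => exact le_rfl
  | succ j _ ih => exact (ih (by omega)).trans (h j (by omega))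

theorem exists_mem_Icc_succ {d : ℕ → ℝ} {x : ℝ} (n : ℕ) (h₀ : d 0 ≤ x) (h₁ : x ≤ d (n + 1)) :
    ∃ j ≤ n, x ∈ Icc (d j) (d (j + 1)) := by
  induction n with
  | zero => exact ⟨0, le_rfl, h₀, h₁⟩
  | succ n ih =>
    rcases le_total x (d (n + 1)) with h | h
    · obtain ⟨j, hj, hx⟩ := ih h
      exact ⟨j, by omega, hx⟩
    · exact ⟨n + 1, le_rfl, h, h₁⟩

theorem exists_mem_Icc_pred {d : ℕ → ℝ} {x : ℝ} (n : ℕ) (h₀ : x ≤ d 0) (h₁ : d (n + 1) ≤ x) :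
    ∃ j ≤ n, x ∈ Icc (d (j + 1)) (d j) := by
  obtain ⟨j, hj, h, h'⟩ :=
    exists_mem_Icc_succ (d := fun j => -d j) n (neg_le_neg h₀) (neg_le_neg h₁)
  exact ⟨j, hj, neg_le_neg_iff.1 h', neg_le_neg_iff.1 h⟩

theorem StrictMonoOn.icc_union {d x e : ℝ} {f : ℝ → ℝ} (hd : d ≤ x) (he : x ≤ e)
    (h₁ : StrictMonoOn f (Icc d x)) (h₂ : StrictMonoOn f (Icc x e)) :
    StrictMonoOn f (Icc d e) :=
  Icc_union_Icc_eq_Icc hd he ▸ h₁.union h₂ (isGreatest_Icc hd) (isLeast_Icc he)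

theorem StrictAntiOn.icc_union {d x e : ℝ} {f : ℝ → ℝ} (hd : d ≤ x) (he : x ≤ e)
    (h₁ : StrictAntiOn f (Icc d x)) (h₂ : StrictAntiOn f (Icc x e)) :
    StrictAntiOn f (Icc d e) :=
  Icc_union_Icc_eq_Icc hd he ▸ h₁.union h₂ (isGreatest_Icc hd) (isLeast_Icc he)

namespace PMFun

variable {a b : ℝ} {F : ℝ → ℝ} {v : ℕ} {c : ℕ → ℝ}

theorem c_le (h : PMFun a b F v c) {i j : ℕ} (hij : i ≤ j) (hj : j ≤ v + 1) : c i ≤ c j :=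
  le_of_le_succ (fun i hi => (h.c_mono i hi).le) hij hj

theorem Icc_subset (h : PMFun a b F v c) {i j : ℕ} (hi : i ≤ v + 1) (hj : j ≤ v + 1) :
    Icc (c i) (c j) ⊆ Icc a b :=
  Icc_subset_Icc (h.c_zero ▸ h.c_le (Nat.zero_le i) hi) (h.c_last ▸ h.c_le hj le_rfl)

theorem finite_forts (h : PMFun a b F v c) : {x | IsFort a b F x}.Finite := by
  refine ((finite_Iic (v + 1)).image c).subset fun x hx => ?_
  have hx' : IsFort a b F x := hx
  obtain ⟨j, hj, h1, h2⟩ := exists_mem_Icc_succ v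
    (h.c_zero ▸ hx'.1.1 : c 0 ≤ x) (h.c_last ▸ hx'.1.2)
  rcases h1.eq_or_lt with h1 | h1
  · exact ⟨j, mem_Iic.2 (by omega), h1⟩
  rcases h2.eq_or_lt with h2 | h2
  · exact ⟨j + 1, mem_Iic.2 (by omega), h2.symm⟩
  exact absurd hx' (not_isFort_of_strictMonoOn_or_strictAntiOn h1 h2 (h.lap_mono j hj))

theorem not_mono_mono (h : PMFun a b F v c) {i : ℕ} (hi : i + 1 ≤ v)
    (h₁ : StrictMonoOn F (Icc (c i) (c (i + 1))))
    (h₂ : StrictMonoOn F (Icc (c (i + 1)) (c (i + 2)))) : False := by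
  have e1 := h.c_mono i (by omega)
  have e2 := h.c_mono (i + 1) hi
  exact not_isFort_of_strictMonoOn_or_strictAntiOn e1 e2
    (Or.inl (h₁.icc_union e1.le e2.le h₂)) (h.fort (i + 1) (by omega) hi)

theorem not_anti_anti (h : PMFun a b F v c) {i : ℕ} (hi : i + 1 ≤ v)
    (h₁ : StrictAntiOn F (Icc (c i) (c (i + 1))))
    (h₂ : StrictAntiOn F (Icc (c (i + 1)) (c (i + 2)))) : False := by
  have e1 := h.c_mono i (by omega)
  have e2 := h.c_mono (i + 1) hi
  exact not_isFort_of_strictMonoOn_or_strictAntiOn e1 e2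
    (Or.inr (h₁.icc_union e1.le e2.le h₂)) (h.fort (i + 1) (by omega) hi)

end PMFun

/-- A chain of closed pieces `P 0, …, P n`, each meeting the later ones only in a common node
`d j`; the values of `F` at the nodes follow the period-four pattern `A, A, B, B`. -/
structure IsChain4 (F : ℝ → ℝ) (n : ℕ) (d : ℕ → ℝ) (P : ℕ → Set ℝ) (A B : ℝ) : Prop where
  closed : ∀ j, IsClosed (P j)
  meet : ∀ i j x, i < j → j ≤ n → x ∈ P i → x ∈ P j → x = d j ∧ x = d (i + 1)
  val01 : ∀ j ≤ n, j % 4 = 0 ∨ j % 4 = 1 → F (d j) = A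
  val23 : ∀ j ≤ n, j % 4 = 2 ∨ j % 4 = 3 → F (d j) = B

/-- The union of the pieces `P j`, `j ≤ n`, whose index has residue `r` or `r'` modulo four. -/
def pieces (n : ℕ) (P : ℕ → Set ℝ) (r r' : ℕ) : Set ℝ :=
  ⋃ j ∈ {j : ℕ | j ≤ n ∧ (j % 4 = r ∨ j % 4 = r')}, P j

theorem mem_pieces {n r r' : ℕ} {P : ℕ → Set ℝ} {x : ℝ} :
    x ∈ pieces n P r r' ↔ ∃ j ≤ n, (j % 4 = r ∨ j % 4 = r') ∧ x ∈ P j := by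
  simp [pieces, and_assoc]

namespace IsChain4

variable {F : ℝ → ℝ} {n : ℕ} {d : ℕ → ℝ} {P : ℕ → Set ℝ} {A B : ℝ}

theorem isClosed_pieces (h : IsChain4 F n d P A B) (r r' : ℕ) : IsClosed (pieces n P r r') :=
  ((finite_Iic n).subset fun _ hj => hj.1).isClosed_biUnion fun j _ => h.closed j

theorem odd_zero (h : IsChain4 F n d P A B) {x : ℝ} (h₁ : x ∈ pieces n P 1 3)
    (h₀ : x ∈ pieces n P 0 0) : F x = A := by
  obtain ⟨i, hi, hi4, hxi⟩ := mem_pieces.1 h₁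
  obtain ⟨j, hj, hj4, hxj⟩ := mem_pieces.1 h₀
  rcases lt_trichotomy i j with hij | hij | hij
  · rw [(h.meet i j x hij hj hxi hxj).1]
    exact h.val01 j hj (by omega)
  · omega
  · rw [(h.meet j i x hij hi hxj hxi).2]
    exact h.val01 _ (by omega) (by omega)

theorem odd_two (h : IsChain4 F n d P A B) {x : ℝ} (h₁ : x ∈ pieces n P 1 3)
    (h₂ : x ∈ pieces n P 2 2) : F x = B := by
  obtain ⟨i, hi, hi4, hxi⟩ := mem_pieces.1 h₁
  obtain ⟨j, hj, hj4, hxj⟩ := mem_pieces.1 h₂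
  rcases lt_trichotomy i j with hij | hij | hij
  · rw [(h.meet i j x hij hj hxi hxj).1]
    exact h.val23 j hj (by omega)
  · omega
  · rw [(h.meet j i x hij hi hxj hxi).2]
    exact h.val23 _ (by omega) (by omega)

theorem zero_two (h : IsChain4 F n d P A B) (hAB : A ≠ B) {x : ℝ} (h₀ : x ∈ pieces n P 0 0)
    (h₂ : x ∈ pieces n P 2 2) : False := by
  obtain ⟨i, hi, hi4, hxi⟩ := mem_pieces.1 h₀
  obtain ⟨j, hj, hj4, hxj⟩ := mem_pieces.1 h₂
  apply hAB
  rcases lt_trichotomy i j with hij | hij | hij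
  · obtain ⟨e1, e2⟩ := h.meet i j x hij hj hxi hxj
    rw [← h.val01 (i + 1) (by omega) (by omega), ← e2, e1, h.val23 j hj (by omega)]
  · omega
  · obtain ⟨e1, e2⟩ := h.meet j i x hij hi hxj hxi
    rw [← h.val01 i hi (by omega), ← e1, e2, h.val23 (j + 1) (by omega) (by omega)]

/-- A point of an even piece that lies beyond the first node is the first node. -/
theorem zero_or_two_of_eq (h : IsChain4 F n d P A B) {x : ℝ}
    (hx : ∀ j ≤ n, x ∈ P j → x = d j) :
    (x ∈ pieces n P 0 0 → F x = A) ∧ (x ∈ pieces n P 2 2 → F x = B) := by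
  constructor <;> intro hp <;> obtain ⟨j, hj, hj4, hxj⟩ := mem_pieces.1 hp <;>
    rw [hx j hj hxj]
  · exact h.val01 j hj (by omega)
  · exact h.val23 j hj (by omega)

end IsChain4

theorem mem_pieces_of_mem {n j : ℕ} {P : ℕ → Set ℝ} {x : ℝ} (hj : j ≤ n) (hx : x ∈ P j) :
    x ∈ pieces n P 1 3 ∨ x ∈ pieces n P 0 0 ∨ x ∈ pieces n P 2 2 := by
  simp only [mem_pieces]
  have : j % 4 = 0 ∨ j % 4 = 2 ∨ j % 4 = 1 ∨ j % 4 = 3 := by omega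
  rcases this with h | h | h
  · exact Or.inr (Or.inl ⟨j, hj, Or.inl h, hx⟩)
  · exact Or.inr (Or.inr ⟨j, hj, Or.inl h, hx⟩)
  · exact Or.inl ⟨j, hj, h, hx⟩

/-- Theorem 2.2, middle-lap case, root increasing on the
characteristic interval. -/
theorem stmt1 (a b : ℝ) (F : ℝ → ℝ) (v : ℕ) (c : ℕ → ℝ) (k : ℕ)
    (hPM : PMFun a b F v c) (hk1 : 1 ≤ k) (hkv : k + 1 ≤ v)
    (hK : Set.MapsTo F (Set.Icc a b) (Set.Icc (c k) (c (k + 1))))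
    (hinc : StrictMonoOn F (Set.Icc (c k) (c (k + 1))))
    (hK0fail :
      (∃ x ∈ Set.Icc a b, F x = c k ∧ F (c k) ≠ c k) ∨
      (∃ x ∈ Set.Icc a b, F x = c (k + 1) ∧ F (c (k + 1)) ≠ c (k + 1)))
    (hcond :
      (c k < F (c (k + 2)) ∧ F (c (k + 2)) < F (c k) ∧
        F (c (k - 1)) = c (k + 1) ∧ F (c (k + 1)) = c (k + 1)) ∨
      (c k = F (c k) ∧ F (c k) = F (c (k + 2)) ∧
        F (c (k + 1)) < F (c (k - 1)) ∧ F (c (k - 1)) < c (k + 1)) ∨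
      (c k < F (c (k + 2)) ∧ F (c (k + 2)) < F (c k) ∧
        F (c (k + 1)) < F (c (k - 1)) ∧ F (c (k - 1)) < c (k + 1)))
    (s : ℕ) (l : ℕ → ℕ)
    (hl0 : l 0 = k - 1) (hlLast : l (s + 1) = 0)
    (hlDec : ∀ j ≤ s, l (j + 1) < l j)
    (hlVal01 : ∀ j ≤ s, j % 4 = 0 ∨ j % 4 = 1 → F (c (l j)) = F (c (k - 1)))
    (hlVal23 : ∀ j ≤ s, j % 4 = 2 ∨ j % 4 = 3 → F (c (l j)) = F (c (k + 2)))
    (hlMax : ∀ j ≤ s, j % 4 = 0 ∨ j % 4 = 1 ∨ j % 4 = 3 →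
      IsGreatest (F '' Set.Icc (c (l (j + 1))) (c (l j))) (F (c (k - 1))))
    (hlMin : ∀ j ≤ s, j % 4 = 1 ∨ j % 4 = 2 ∨ j % 4 = 3 →
      IsLeast (F '' Set.Icc (c (l (j + 1))) (c (l j))) (F (c (k + 2))))
    (t : ℕ) (r : ℕ → ℕ)
    (hr0 : r 0 = k + 2) (hrLast : r (t + 1) = v + 1)
    (hrInc : ∀ j ≤ t, r j < r (j + 1))
    (hrVal01 : ∀ j ≤ t, j % 4 = 0 ∨ j % 4 = 1 → F (c (r j)) = F (c (k + 2)))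
    (hrVal23 : ∀ j ≤ t, j % 4 = 2 ∨ j % 4 = 3 → F (c (r j)) = F (c (k - 1)))
    (hrMin : ∀ j ≤ t, j % 4 = 0 ∨ j % 4 = 1 ∨ j % 4 = 3 →
      IsLeast (F '' Set.Icc (c (r j)) (c (r (j + 1)))) (F (c (k + 2))))
    (hrMax : ∀ j ≤ t, j % 4 = 1 ∨ j % 4 = 2 ∨ j % 4 = 3 →
      IsGreatest (F '' Set.Icc (c (r j)) (c (r (j + 1)))) (F (c (k - 1)))) :
    ∃ f : ℝ → ℝ, ContinuousOn f (Set.Icc a b) ∧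
      Set.MapsTo f (Set.Icc a b) (Set.Icc a b) ∧
      (∀ x ∈ Set.Icc a b, f (f x) = F x) ∧
      StrictMonoOn f (Set.Icc (c k) (c (k + 1))) ∧
      HeightEq a b f 2 := by
  obtain ⟨k, rfl⟩ : ∃ k', k = k' + 1 := ⟨k - 1, by omega⟩
  simp only [Nat.add_sub_cancel] at *
  obtain ⟨n, rfl⟩ : ∃ n, k = n + 1 := ⟨k - 1, by have := hlDec 0 (by omega); omega⟩
  have hl_le : ∀ j ≤ s + 1, l j ≤ n + 1 := fun j hj =>
    hl0 ▸ le_of_le_succ (γ := ℕᵒᵈ) (g := l) (fun j hj => (hlDec j hj).le) (Nat.zero_le j) hj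
  have hr_le : ∀ j ≤ t + 1, r j ≤ v + 1 := fun j hj =>
    hrLast ▸ le_of_le_succ (g := r) (fun j hj => (hrInc j hj).le) hj le_rfl
  have hr_ge : ∀ j ≤ t + 1, n + 1 + 1 + 2 ≤ r j := fun j hj =>
    hr0 ▸ le_of_le_succ (g := r) (fun j hj => (hrInc j hj).le) (Nat.zero_le j) hj
  have hq : n + 1 + 1 + 2 ≤ v + 1 := by omega
  have hdl : ∀ i j, i ≤ j → j ≤ s + 1 → c (l j) ≤ c (l i) := fun i j hij hj =>
    hPM.c_le (le_of_le_succ (γ := ℕᵒᵈ) (g := l) (fun j hj => (hlDec j hj).le) hij hj)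
      ((hl_le i (by omega)).trans (by omega))
  have hdr : ∀ i j, i ≤ j → j ≤ t + 1 → c (r i) ≤ c (r j) := fun i j hij hj =>
    hPM.c_le (le_of_le_succ (g := r) (fun j hj => (hrInc j hj).le) hij hj) (hr_le j hj)
  have hpα := hPM.c_mono (n + 1) (by omega)
  have hαβ := hPM.c_mono (n + 1 + 1) (by omega)
  have hβq := hPM.c_mono (n + 1 + 1 + 1) (by omega)
  have hpq := hPM.Icc_subset (i := n + 1) (j := n + 1 + 1 + 2) (by omega) hq
  have hFp : StrictAntiOn F (Icc (c (n + 1)) (c (n + 1 + 1))) :=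
    (hPM.lap_mono (n + 1) (by omega)).resolve_left fun h =>
      hPM.not_mono_mono (by omega) h hinc
  have hFq : StrictAntiOn F (Icc (c (n + 1 + 1 + 1)) (c (n + 1 + 1 + 2))) :=
    (hPM.lap_mono (n + 1 + 1 + 1) (by omega)).resolve_left fun h =>
      hPM.not_mono_mono (by omega) hinc h
  have hFn : StrictMonoOn F (Icc (c n) (c (n + 1))) :=
    (hPM.lap_mono n (by omega)).resolve_right fun h =>
      hPM.not_anti_anti (by omega) h hFp
  have hα : (c (n + 1 + 1) < F (c (n + 1 + 1 + 2)) ∧ F (c (n + 1 + 1 + 2)) < F (c (n + 1 + 1))) ∨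
      (c (n + 1 + 1) = F (c (n + 1 + 1 + 2)) ∧ F (c (n + 1 + 1 + 2)) = F (c (n + 1 + 1))) := by
    rcases hcond with h | h | h
    · exact Or.inl ⟨h.1, h.2.1⟩
    · exact Or.inr ⟨h.1.trans h.2.1, h.2.1.symm⟩
    · exact Or.inl ⟨h.1, h.2.1⟩
  have hβ : (F (c (n + 1 + 1 + 1)) < F (c (n + 1)) ∧ F (c (n + 1)) < c (n + 1 + 1 + 1)) ∨
      (F (c (n + 1)) = c (n + 1 + 1 + 1) ∧ F (c (n + 1 + 1 + 1)) = F (c (n + 1))) := by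
    rcases hcond with h | h | h
    · exact Or.inr ⟨h.2.2.1, h.2.2.2.trans h.2.2.1.symm⟩
    · exact Or.inl h.2.2
    · exact Or.inl h.2.2
  have hmα : F (c (n + 1 + 1 + 2)) ≤ F (c (n + 1 + 1)) := by rcases hα with h | h <;> linarith
  have hβM : F (c (n + 1 + 1 + 1)) ≤ F (c (n + 1)) := by rcases hβ with h | h <;> linarith
  have hαβF := hinc ⟨le_rfl, hαβ.le⟩ ⟨hαβ.le, le_rfl⟩ hαβ
  have hmM : F (c (n + 1 + 1 + 2)) < F (c (n + 1)) := by linarith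
  set PL : ℕ → Set ℝ := fun j => Icc (c (l (j + 1))) (c (l j)) with hPL
  set PR : ℕ → Set ℝ := fun j => Icc (c (r j)) (c (r (j + 1))) with hPR
  have chL : IsChain4 F s (fun j => c (l j)) PL (F (c (n + 1))) (F (c (n + 1 + 1 + 2))) := by
    refine ⟨fun j => isClosed_Icc, fun i j x hij hj hi hj' => ?_, hlVal01, hlVal23⟩
    have := hdl (i + 1) j hij (by omega)
    exact ⟨le_antisymm hj'.2 (this.trans hi.1), le_antisymm (hj'.2.trans this) hi.1⟩
  have chR : IsChain4 F t (fun j => c (r j)) PR (F (c (n + 1 + 1 + 2))) (F (c (n + 1))) := by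
    refine ⟨fun j => isClosed_Icc, fun i j x hij hj hi hj' => ?_, hrVal01, hrVal23⟩
    have := hdr (i + 1) j hij (by omega)
    exact ⟨le_antisymm (hi.2.trans this) hj'.1, le_antisymm hi.2 (this.trans hj'.1)⟩
  have hLle : ∀ u u' x, x ∈ pieces s PL u u' → x ≤ c (n + 1) := fun u u' x hx => by
    obtain ⟨j, hj, -, hxj⟩ := mem_pieces.1 hx
    exact hl0 ▸ hxj.2.trans (hdl 0 j (Nat.zero_le j) (by omega))
  have hRge : ∀ u u' x, x ∈ pieces t PR u u' → c (n + 1 + 1 + 2) ≤ x := fun u u' x hx => by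
    obtain ⟨j, hj, -, hxj⟩ := mem_pieces.1 hx
    exact hr0 ▸ (hdr 0 j (Nat.zero_le j) (by omega)).trans hxj.1
  have midL : ∀ x, c (n + 1) ≤ x → ∀ j ≤ s, x ∈ PL j → x = c (l j) := fun x hx j hj hxj =>
    le_antisymm hxj.2 ((hdl 0 j (Nat.zero_le j) (by omega)).trans (hl0 ▸ hx))
  have midR : ∀ x, x ≤ c (n + 1 + 1 + 2) → ∀ j ≤ t, x ∈ PR j → x = c (r j) := fun x hx j hj hxj =>
    le_antisymm ((hr0 ▸ hx).trans (hdr 0 j (Nat.zero_le j) (by omega))) hxj.1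
  have hsep : ∀ u u' w w' x, x ∈ pieces s PL u u' → x ∈ pieces t PR w w' → False :=
    fun u u' w w' x h h' => by linarith [hLle u u' x h, hRge w w' x h']
  set S : Set ℝ := Icc (c (n + 1)) (c (n + 1 + 1 + 2)) ∪ (pieces s PL 1 3 ∪ pieces t PR 1 3)
    with hS
  set R : Set ℝ := pieces s PL 0 0 ∪ pieces t PR 2 2 with hR
  set L : Set ℝ := pieces s PL 2 2 ∪ pieces t PR 0 0 with hL
  obtain ⟨f, ψ, e, hfc, hfm, hff, hψ, he, hfS, hfR⟩ := exists_root_of_cover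
    (S := S) (R := R) (L := L)
    (isClosed_Icc.union ((chL.isClosed_pieces 1 3).union (chR.isClosed_pieces 1 3)))
    ((chL.isClosed_pieces 0 0).union (chR.isClosed_pieces 2 2))
    ((chL.isClosed_pieces 2 2).union (chR.isClosed_pieces 0 0))
    (by
      intro x hx
      rcases le_total x (c (n + 1)) with h | h
      · obtain ⟨j, hj, hxj⟩ := exists_mem_Icc_pred (d := fun j => c (l j)) s
          (by simpa only [hl0] using h) (by simpa only [hlLast, hPM.c_zero] using hx.1)
        rcases mem_pieces_of_mem (P := PL) hj hxj with h | h | h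
        · exact Or.inl (Or.inr (Or.inl h))
        · exact Or.inr (Or.inl (Or.inl h))
        · exact Or.inr (Or.inr (Or.inl h))
      rcases le_total x (c (n + 1 + 1 + 2)) with h' | h'
      · exact Or.inl (Or.inl ⟨h, h'⟩)
      · obtain ⟨j, hj, hxj⟩ := exists_mem_Icc_succ (d := fun j => c (r j)) t
          (by simpa only [hr0] using h') (by simpa only [hrLast, hPM.c_last] using hx.2)
        rcases mem_pieces_of_mem (P := PR) hj hxj with h | h | h
        · exact Or.inl (Or.inr (Or.inr h))
        · exact Or.inr (Or.inr (Or.inr h))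
        · exact Or.inr (Or.inl (Or.inr h)))
    subset_union_left hpα hαβ hβq hpq hPM.cont hK hFp hinc hFq rfl rfl hα hβ
    (by
      rintro x (h | h | h) (h' | h')
      · exact (chL.zero_or_two_of_eq (midL x h.1)).1 h'
      · exact (chR.zero_or_two_of_eq (midR x h.2)).2 h'
      · exact chL.odd_zero h h'
      · exact (hsep _ _ _ _ x h h').elim
      · exact (hsep _ _ _ _ x h' h).elim
      · exact chR.odd_two h h')
    (by
      rintro x (h | h | h) (h' | h')
      · exact (chL.zero_or_two_of_eq (midL x h.1)).2 h'
      · exact (chR.zero_or_two_of_eq (midR x h.2)).1 h'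
      · exact chL.odd_two h h'
      · exact (hsep _ _ _ _ x h h').elim
      · exact (hsep _ _ _ _ x h' h).elim
      · exact chR.odd_zero h h')
    (by
      rw [disjoint_left]
      rintro x (h | h) (h' | h')
      · exact chL.zero_two hmM.ne' h h'
      · exact hsep _ _ _ _ x h h'
      · exact hsep _ _ _ _ x h' h
      · exact chR.zero_two hmM.ne h' h)
    (by
      rintro x (⟨h1, h2⟩ | h | h)
      · rcases le_total x (c (n + 1 + 1)) with h3 | h3
        · have e1 := hFp.antitoneOn ⟨le_rfl, hpα.le⟩ ⟨h1, h3⟩ h1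
          have e2 := hFp.antitoneOn ⟨h1, h3⟩ ⟨hpα.le, le_rfl⟩ h3
          exact ⟨by linarith, by linarith⟩
        rcases le_total x (c (n + 1 + 1 + 1)) with h4 | h4
        · have e1 := hinc.monotoneOn ⟨le_rfl, hαβ.le⟩ ⟨h3, h4⟩ h3
          have e2 := hinc.monotoneOn ⟨h3, h4⟩ ⟨hαβ.le, le_rfl⟩ h4
          exact ⟨by linarith, by linarith⟩
        · have e1 := hFq.antitoneOn ⟨le_rfl, hβq.le⟩ ⟨h4, h2⟩ h4
          have e2 := hFq.antitoneOn ⟨h4, h2⟩ ⟨hβq.le, le_rfl⟩ h2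
          exact ⟨by linarith, by linarith⟩
      · obtain ⟨j, hj, hj4, hxj⟩ := mem_pieces.1 h
        exact ⟨(hlMin j hj (by omega)).2 ⟨x, hxj, rfl⟩, (hlMax j hj (by omega)).2 ⟨x, hxj, rfl⟩⟩
      · obtain ⟨j, hj, hj4, hxj⟩ := mem_pieces.1 h
        exact ⟨(hrMin j hj (by omega)).2 ⟨x, hxj, rfl⟩, (hrMax j hj (by omega)).2 ⟨x, hxj, rfl⟩⟩)
    (by
      rintro x (h | h) <;> obtain ⟨j, hj, hj4, hxj⟩ := mem_pieces.1 h
      · exact (hlMax j hj (by omega)).2 ⟨x, hxj, rfl⟩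
      · exact (hrMax j hj (by omega)).2 ⟨x, hxj, rfl⟩)
    (by
      rintro x (h | h) <;> obtain ⟨j, hj, hj4, hxj⟩ := mem_pieces.1 h
      · exact (hlMin j hj (by omega)).2 ⟨x, hxj, rfl⟩
      · exact (hrMin j hj (by omega)).2 ⟨x, hxj, rfl⟩)
  have hfmid : StrictMonoOn f (Icc (c (n + 1 + 1)) (c (n + 1 + 1 + 1))) :=
    (hψ.comp_strictMonoOn hinc).congr fun x hx =>
      (hfS x (Or.inl ⟨hpα.le.trans hx.1, hx.2.trans hβq.le⟩)).symm
  have hfp : StrictAntiOn f (Icc (c (n + 1)) (c (n + 1 + 1))) :=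
    (hψ.comp_strictAntiOn hFp).congr fun x hx =>
      (hfS x (Or.inl ⟨hx.1, hx.2.trans (hαβ.trans hβq).le⟩)).symm
  have hfn : StrictAntiOn f (Icc (c n) (c (n + 1))) :=
    (he.comp_strictMonoOn hFn).congr fun x hx =>
      (hfR x (Or.inl (mem_pieces.2 ⟨0, Nat.zero_le s, Or.inl rfl,
        (hPM.c_le (by have := hlDec 0 (Nat.zero_le s); omega) (by omega)).trans hx.1,
        hl0.symm ▸ hx.2⟩))).symm
  have hnp := hPM.c_mono n (by omega)
  exact ⟨f, hfc, hfm, hff, hfmid, heightEq_two hfc hff hPM.finite_forts hfmid hK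
    (isFort_of_anti_of_mono hpα hαβ ((Icc_subset_Icc_right hβq.le).trans hpq) hfp hfmid)
    (hPM.fort (n + 1) (by omega) (by omega))
    (not_isFort_of_strictMonoOn_or_strictAntiOn hnp hpα
      (Or.inr (hfn.icc_union hnp.le hpα.le hfp)))⟩
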